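/- Let n ≥ 1 and let φ : ℝ × ℝⁿ → ℝⁿ, u : ℝ × ℝⁿ → ℝⁿ and ρ : ℝ × ℝⁿ → ℝ be smooth, with ∂ₜφ(t,x) = u(t, φ(t,x)) and det D_xφ(t,x) > 0 for all (t,x). Suppose that for each x the quantity ρ(t, φ(t,x)) · det D_xφ(t,x) is independent of t (i.e., ρ is the pushforward density of its initial value under the flow). Then ( ∂ₜρ + div(ρ u) )(t, φ(t,x)) = 0 for all (t,x); in particular, if moreover φ(t,·) is surjective for each t, then the continuity equation ∂ₜρ + div(ρ u) = 0 holds at every point. -/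

import Mathlib

noncomputable section

open MeasureTheory Complex
open scoped ContDiff RealInnerProductSpace

/-- Euclidean space `ℝⁿ`. -/
abbrev En (n : ℕ) : Type := EuclideanSpace ℝ (Fin n)

/-- The `i`-th standard basis vector of `ℝⁿ`. -/
def ee {n : ℕ} (i : Fin n) : En n := EuclideanSpace.single i 1

/-- Laplacian of a real-valued function on `ℝⁿ` (trace of the Hessian). -/
def lapR {n : ℕ} (f : En n → ℝ) (x : En n) : ℝ :=
  ∑ i, fderiv ℝ (fun y => fderiv ℝ f y (ee i)) x (ee i)

/-- Laplacian of a complex-valued function on `ℝⁿ`. -/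
def lapC {n : ℕ} (f : En n → ℂ) (x : En n) : ℂ :=
  ∑ i, fderiv ℝ (fun y => fderiv ℝ f y (ee i)) x (ee i)

/-- Divergence of a vector field on `ℝⁿ`. -/
def dvg {n : ℕ} (v : En n → En n) (x : En n) : ℝ :=
  ∑ i, fderiv ℝ v x (ee i) i

/-- Jacobian matrix of a map `ℝⁿ → ℝⁿ`. -/
def jac {n : ℕ} (φ : En n → En n) (x : En n) : Matrix (Fin n) (Fin n) ℝ :=
  fun i j => fderiv ℝ φ x (ee j) i

/-- Jacobi's formula: if `M' = A M` at `t`, then `(det M)' = tr A · det M` at `t`. -/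
theorem hasDerivAt_det_of_hasDerivAt_mul {ι : Type*} [Fintype ι] [DecidableEq ι]
    {M : ℝ → Matrix ι ι ℝ} {A : Matrix ι ι ℝ} {t : ℝ}
    (hM : ∀ i j, HasDerivAt (fun s => M s i j) ((A * M t) i j) t) :
    HasDerivAt (fun s => (M s).det) (A.trace * (M t).det) t := by
  let D : ContinuousMultilinearMap ℝ (fun _ : ι => ι → ℝ) ℝ :=
    { (Matrix.detRowAlternating (n := ι) (R := ℝ)).toMultilinearMap with
      cont := Continuous.matrix_det (A := fun M : Matrix ι ι ℝ => M) continuous_id }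
  have hM' : HasDerivAt (fun s => (M s : ι → ι → ℝ)) (fun i => (A * M t) i) t :=
    hasDerivAt_pi.2 fun i => hasDerivAt_pi.2 fun j => hM i j
  have h := (D.hasFDerivAt (M t)).comp_hasDerivAt t hM'
  have hval : D.linearDeriv (M t) (fun i => (A * M t) i) = A.trace * (M t).det := by
    refine (ContinuousMultilinearMap.linearDeriv_apply D _ _).trans ?_
    rw [Matrix.trace, Finset.sum_mul]
    refine Finset.sum_congr rfl fun i _ => ?_
    have hrow : (A * M t) i = ∑ k, A i k • M t k := by
      ext j
      simp [Matrix.mul_apply]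
    rw [hrow]
    exact Matrix.det_updateRow_sum (M t) i (A i)
  rw [hval] at h
  exact h

theorem eq_sum_smul_ee {n : ℕ} (v : En n) : v = ∑ k, v k • (ee k : En n) := by
  simpa [ee] using ((EuclideanSpace.basisFun (Fin n) ℝ).sum_repr v).symm

theorem dvg_eq_trace_jac {n : ℕ} (v : En n → En n) (x : En n) : dvg v x = (jac v x).trace := rfl

theorem jac_comp {n : ℕ} {f g : En n → En n} {x : En n}
    (hf : DifferentiableAt ℝ f (g x)) (hg : DifferentiableAt ℝ g x) :
    jac (fun y => f (g y)) x = jac f (g x) * jac g x := by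
  ext i j
  change fderiv ℝ (f ∘ g) x (ee j) i = _
  rw [fderiv_comp x hf hg, ContinuousLinearMap.comp_apply,
    eq_sum_smul_ee (fderiv ℝ g x (ee j)), Matrix.mul_apply]
  simp [jac, mul_comm]

theorem dvg_smul {n : ℕ} {r : En n → ℝ} {v : En n → En n} {x : En n}
    (hr : DifferentiableAt ℝ r x) (hv : DifferentiableAt ℝ v x) :
    dvg (fun y => r y • v y) x = fderiv ℝ r x (v x) + r x * dvg v x := by
  conv_rhs => rw [eq_sum_smul_ee (v x)]
  simp only [dvg, fderiv_fun_smul hr hv, map_sum, map_smul, Finset.mul_sum,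
    ← Finset.sum_add_distrib]
  refine Finset.sum_congr rfl fun i _ => ?_
  simp
  ring

section TimeDependent

variable {E F : Type*} [NormedAddCommGroup E] [NormedSpace ℝ E]
  [NormedAddCommGroup F] [NormedSpace ℝ F]

theorem fderiv_slice {f : ℝ → E → F} {t : ℝ} {x : E}
    (hf : DifferentiableAt ℝ (Function.uncurry f) (t, x)) (e : E) :
    fderiv ℝ (f t) x e = fderiv ℝ (Function.uncurry f) (t, x) (0, e) := by
  have h := hf.hasFDerivAt.comp x ((hasFDerivAt_const t x).prodMk (hasFDerivAt_id x))
  change HasFDerivAt (f t) _ x at h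
  simp [h.fderiv]

theorem hasDerivAt_slice {f : ℝ → E → F} {t : ℝ} {x : E}
    (hf : DifferentiableAt ℝ (Function.uncurry f) (t, x)) :
    HasDerivAt (fun s => f s x) (fderiv ℝ (Function.uncurry f) (t, x) (1, 0)) t :=
  hf.hasFDerivAt.comp_hasDerivAt (f := fun s => (s, x)) t
    ((hasDerivAt_id t).prodMk (hasDerivAt_const t x))

/-- The total derivative of `f` along a curve `γ`. -/
theorem hasDerivAt_along {f : ℝ → E → F} {γ : ℝ → E} {γ' : E} {t : ℝ}
    (hf : DifferentiableAt ℝ (Function.uncurry f) (t, γ t)) (hγ : HasDerivAt γ γ' t) :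
    HasDerivAt (fun s => f s (γ s)) (deriv (fun s => f s (γ t)) t + fderiv ℝ (f t) (γ t) γ') t := by
  have h : HasDerivAt (fun s => f s (γ s))
      (fderiv ℝ (Function.uncurry f) (t, γ t) (1, γ')) t :=
    hf.hasFDerivAt.comp_hasDerivAt (f := fun s => (s, γ s)) t ((hasDerivAt_id t).prodMk hγ)
  rwa [(hasDerivAt_slice hf).deriv, fderiv_slice hf, ← map_add, Prod.mk_add_mk, add_zero,
    zero_add]

/-- Time and space derivatives of a `C²` map commute. -/
theorem hasDerivAt_fderiv_slice {f : ℝ → E → F} (hf : ContDiff ℝ 2 (Function.uncurry f))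
    (t : ℝ) (x e : E) :
    HasDerivAt (fun s => fderiv ℝ (f s) x e)
      (fderiv ℝ (fun y => deriv (fun s => f s y) t) x e) t := by
  have hd : Differentiable ℝ (Function.uncurry f) := hf.differentiable (by norm_num)
  have hd' : Differentiable ℝ (fderiv ℝ (Function.uncurry f)) :=
    (hf.fderiv_right (m := 1) (by norm_num)).differentiable (by norm_num)
  have hspace : (fun s => fderiv ℝ (f s) x e) =
      fun s => fderiv ℝ (Function.uncurry f) (s, x) (0, e) :=
    funext fun s => fderiv_slice (hd _) e
  have htime : (fun y => deriv (fun s => f s y) t) =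
      fun y => fderiv ℝ (Function.uncurry f) (t, y) (1, 0) :=
    funext fun y => (hasDerivAt_slice (hd _)).deriv
  have hsymm := (hf.contDiffAt (x := (t, x))).isSymmSndFDerivAt (by simp)
  have h₁ : HasDerivAt (fun s => fderiv ℝ (Function.uncurry f) (s, x))
      (fderiv ℝ (fderiv ℝ (Function.uncurry f)) (t, x) (1, 0)) t :=
    (hd' (t, x)).hasFDerivAt.comp_hasDerivAt t ((hasDerivAt_id t).prodMk (hasDerivAt_const t x))
  have h₂ := (hd' (t, x)).hasFDerivAt.comp x
    ((hasFDerivAt_const t x).prodMk (hasFDerivAt_id x))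
  have h₃ := h₂.clm_apply (hasFDerivAt_const ((1, 0) : ℝ × E) x)
  simp only [Function.comp_def] at h₃
  rw [hspace, htime, h₃.fderiv]
  convert h₁.clm_apply (hasDerivAt_const t ((0, e) : ℝ × E)) using 1
  simpa using hsymm.eq (0, e) (1, 0)

end TimeDependent

/-- Liouville's formula for the Jacobian determinant of a flow. -/
theorem hasDerivAt_det_jac_flow {n : ℕ} {φ u : ℝ → En n → En n}
    (hφ : ContDiff ℝ 2 (Function.uncurry φ)) {t : ℝ} (hu : Differentiable ℝ (u t))
    (hflow : ∀ x, deriv (fun s => φ s x) t = u t (φ t x)) (x : En n) :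
    HasDerivAt (fun s => (jac (φ s) x).det)
      (dvg (u t) (φ t x) * (jac (φ t) x).det) t := by
  have hφt : Differentiable ℝ (φ t) :=
    (hφ.comp (contDiff_prodMk_right t)).differentiable (by norm_num)
  rw [dvg_eq_trace_jac]
  refine hasDerivAt_det_of_hasDerivAt_mul fun i j => ?_
  rw [← jac_comp (hu _) (hφt x), ← funext hflow]
  exact (EuclideanSpace.proj (𝕜 := ℝ) i).hasFDerivAt.comp_hasDerivAt t
    (hasDerivAt_fderiv_slice hφ t x (ee j))

/-- if `ρ` is the pushforward of its initial value under the flow of `u`,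
then the continuity equation holds along the flow (and everywhere if the flow maps are
surjective). -/
theorem pushforward_continuity_equation
    (n : ℕ) (hn : 1 ≤ n)
    (φ u : ℝ → En n → En n) (ρ : ℝ → En n → ℝ)
    (hφ : ContDiff ℝ ∞ (Function.uncurry φ))
    (hu : ContDiff ℝ ∞ (Function.uncurry u))
    (hρ : ContDiff ℝ ∞ (Function.uncurry ρ))
    (hflow : ∀ t x, deriv (fun s => φ s x) t = u t (φ t x))
    (hdet : ∀ t x, 0 < (jac (φ t) x).det)
    (hpush : ∀ (x : En n) (t₁ t₂ : ℝ),
      ρ t₁ (φ t₁ x) * (jac (φ t₁) x).det = ρ t₂ (φ t₂ x) * (jac (φ t₂) x).det) :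
    (∀ t x, deriv (fun s => ρ s (φ t x)) t + dvg (fun y => ρ t y • u t y) (φ t x) = 0)
    ∧ ((∀ t, Function.Surjective (φ t)) →
        ∀ t x, deriv (fun s => ρ s x) t + dvg (fun y => ρ t y • u t y) x = 0) := by
  have main : ∀ t x,
      deriv (fun s => ρ s (φ t x)) t + dvg (fun y => ρ t y • u t y) (φ t x) = 0 := by
    intro t x
    have hut : Differentiable ℝ (u t) :=
      (hu.comp (contDiff_prodMk_right t)).differentiable (by simp)
    have hρt : Differentiable ℝ (ρ t) :=
      (hρ.comp (contDiff_prodMk_right t)).differentiable (by simp)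
    have hγ : HasDerivAt (fun s => φ s x) (u t (φ t x)) t := by
      rw [← hflow]
      exact (hasDerivAt_slice (hφ.differentiable (by simp) _)).differentiableAt.hasDerivAt
    have hJ := hasDerivAt_det_jac_flow (contDiff_infty.1 hφ 2) hut (hflow t) x
    have hprod := (hasDerivAt_along (hρ.differentiable (by simp) _) hγ).mul hJ
    have hzero := hprod.unique
      ((hasDerivAt_const t (ρ t (φ t x) * (jac (φ t) x).det)).congr_of_eventuallyEq
        (.of_forall fun s => hpush x s t))
    rw [dvg_smul (hρt _) (hut _)]
    refine (mul_eq_zero.1 ?_).resolve_right (hdet t x).ne'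
    linear_combination hzero
  refine ⟨main, fun hsurj t x => ?_⟩
  obtain ⟨y, rfl⟩ := hsurj t x
  exact main t y
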